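/- Let n ≥ 3 and p > 1, and assume ψ satisfies (H1)–(H3). Let 0 ≤ β < α and let u_α, u_β be the radial solutions with initial values α and β. If u_α and u_β are both stable, then u_α(r) > u_β(r) for every r ≥ 0; in particular every stable radial solution with positive initial value is strictly positive on [0, ∞). -/

import Mathlib

open Real MeasureTheory Filter Set Asymptotics

noncomputable section

/-- (H1): ψ is C² on [0,∞), ψ(0) = ψ''(0) = 0, ψ'(0) = 1, ψ > 0 on (0,∞). -/
def H1 (ψ : ℝ → ℝ) : Prop :=
  ContDiffOn ℝ 2 ψ (Ici 0) ∧ ψ 0 = 0 ∧ deriv ψ 0 = 1 ∧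
    deriv (deriv ψ) 0 = 0 ∧ ∀ r > (0 : ℝ), 0 < ψ r

/-- (H2): ψ' ≥ 0 on (0,∞). -/
def H2 (ψ : ℝ → ℝ) : Prop := ∀ r > (0 : ℝ), 0 ≤ deriv ψ r

/-- (H3): liminf_{r→∞} ψ'(r)/ψ(r) > 0, i.e. ψ'/ψ is eventually bounded below
by a positive constant. -/
def H3 (ψ : ℝ → ℝ) : Prop := ∃ c > (0 : ℝ), ∀ᶠ r in atTop, c ≤ deriv ψ r / ψ r

/-- A radial solution of the Lane–Emden–Fowler equation with initial value α. -/
def IsRadialSolution (n : ℕ) (p : ℝ) (ψ u : ℝ → ℝ) (α : ℝ) : Prop :=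
  ContDiffOn ℝ 2 u (Ici 0) ∧ u 0 = α ∧ deriv u 0 = 0 ∧
    ∀ r > (0 : ℝ), deriv (deriv u) r + ((n : ℝ) - 1) * (deriv ψ r / ψ r) * deriv u r
      + |u r| ^ (p - 1) * u r = 0

/-- Linearized stability of a radial solution. -/
def Stable (n : ℕ) (p : ℝ) (ψ u : ℝ → ℝ) : Prop :=
  ∀ χ : ℝ → ℝ, ContDiff ℝ 1 χ → HasCompactSupport χ →
    p * ∫ r in Ioi (0:ℝ), |u r| ^ (p - 1) * (χ r) ^ 2 * ψ r ^ (n - 1) ≤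
      ∫ r in Ioi (0:ℝ), (deriv χ r) ^ 2 * ψ r ^ (n - 1)

open scoped Topology

/-- Stability tested against a function on `[0, R]` that vanishes to first order at `R`. -/
lemma Stable.integral_le_of_deriv_eq_zero {n : ℕ} {p : ℝ} {ψ u : ℝ → ℝ} (hs : Stable n p ψ u)
    {R : ℝ} (hR : 0 < R) {v v' : ℝ → ℝ}
    (hv : ContinuousOn v (Icc 0 R)) (hv' : ContinuousOn v' (Icc 0 R))
    (hd : ∀ r ∈ Ioo 0 R, HasDerivAt v (v' r) r) (hvR : v R = 0) (hvR' : v' R = 0) :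
    p * ∫ r in (0:ℝ)..R, |u r| ^ (p - 1) * (v r) ^ 2 * ψ r ^ (n - 1) ≤
      ∫ r in (0:ℝ)..R, (v' r) ^ 2 * ψ r ^ (n - 1) := by
  set g : ℝ → ℝ := IccExtend hR.le ((Icc 0 R).domRestrict v')
  have hg : Continuous g := hv'.domRestrict.Icc_extend'
  have hg_eq : ∀ r ∈ Icc 0 R, g r = v' r := fun r hr => IccExtend_of_mem _ _ hr
  have hg_right : ∀ r, R ≤ r → g r = 0 := fun r hr =>
    (IccExtend_of_right_le _ _ hr).trans hvR'
  set χ₀ : ℝ → ℝ := fun r => ∫ t in R..r, g t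
  have hχ₀_deriv : ∀ r, HasDerivAt χ₀ (g r) r := fun r =>
    intervalIntegral.integral_hasDerivAt_right (hg.intervalIntegrable _ _)
      hg.aestronglyMeasurable.stronglyMeasurableAtFilter hg.continuousAt
  have hχ₀_contDiff : ContDiff ℝ 1 χ₀ := by
    rw [contDiff_one_iff_deriv]
    refine ⟨fun r => (hχ₀_deriv r).differentiableAt, ?_⟩
    rwa [show deriv χ₀ = g from funext fun r => (hχ₀_deriv r).deriv]
  have hχ₀_eq : ∀ r ∈ Icc 0 R, χ₀ r = v r := by
    intro r hr
    have hsub : Icc r R ⊆ Icc 0 R := Icc_subset_Icc_left hr.1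
    have h := intervalIntegral.integral_eq_sub_of_hasDerivAt_of_le hr.2 (hv.mono hsub)
      (f' := g) (fun x hx => by
        have hx' : x ∈ Ioo 0 R := ⟨hr.1.trans_lt hx.1, hx.2⟩
        rw [hg_eq x (Ioo_subset_Icc_self hx')]
        exact hd x hx') (hg.intervalIntegrable _ _)
    simp only [χ₀]
    rw [intervalIntegral.integral_symm, h, hvR]
    ring
  have hχ₀_right : ∀ r, R ≤ r → χ₀ r = 0 := by
    intro r hr
    refine intervalIntegral.integral_zero_ae (Filter.Eventually.of_forall fun t ht => ?_)
    rw [uIoc_of_le hr] at ht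
    exact hg_right t ht.1.le
  let η : ContDiffBump (0 : ℝ) := ⟨R + 1, R + 2, by linarith, by linarith⟩
  have hη : ∀ r ∈ Ioo (-(R + 1)) (R + 1), η r = 1 := fun r hr =>
    η.one_of_mem_closedBall (by
      rw [mem_closedBall_zero_iff, Real.norm_eq_abs]
      exact (abs_lt.mpr hr).le)
  set χ : ℝ → ℝ := fun r => η r * χ₀ r
  have hχ_left : ∀ r ∈ Ioo (-(R + 1)) (R + 1), χ r = χ₀ r := fun r hr => by
    simp [χ, hη r hr]
  have hχ_right : ∀ r, R ≤ r → χ r = 0 := fun r hr => by simp [χ, hχ₀_right r hr]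
  have hχ_deriv_left : ∀ r ∈ Ioc 0 R, deriv χ r = v' r := by
    intro r hr
    have hmem : Ioo (-(R + 1)) (R + 1) ∈ 𝓝 r :=
      Ioo_mem_nhds (by linarith [hr.1]) (by linarith [hr.2])
    have : χ =ᶠ[𝓝 r] χ₀ := Filter.eventuallyEq_of_mem hmem hχ_left
    rw [this.deriv_eq, (hχ₀_deriv r).deriv, hg_eq r (Ioc_subset_Icc_self hr)]
  have hχ_deriv_right : ∀ r, R < r → deriv χ r = 0 := by
    intro r hr
    have : χ =ᶠ[𝓝 r] fun _ => 0 :=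
      Filter.eventuallyEq_of_mem (Ioi_mem_nhds hr) fun x hx => hχ_right x (le_of_lt hx)
    rw [this.deriv_eq, deriv_const]
  have key := hs χ (η.contDiff.mul hχ₀_contDiff) η.hasCompactSupport.mul_right
  have hdiff : ∀ r ∈ Ioi (0 : ℝ) \ Ioc 0 R, R < r := fun r hr => by
    by_contra h
    exact hr.2 ⟨hr.1, not_lt.mp h⟩
  rw [setIntegral_eq_of_subset_of_forall_sdiff_eq_zero measurableSet_Ioi
      (Ioc_subset_Ioi_self : Ioc 0 R ⊆ Ioi 0) (fun r hr => by
        simp [hχ_right r (hdiff r hr).le]),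
    setIntegral_eq_of_subset_of_forall_sdiff_eq_zero measurableSet_Ioi
      (Ioc_subset_Ioi_self : Ioc 0 R ⊆ Ioi 0) (fun r hr => by
        simp [hχ_deriv_right r (hdiff r hr)])] at key
  rw [intervalIntegral.integral_of_le hR.le, intervalIntegral.integral_of_le hR.le]
  have hleft : ∫ r in Ioc 0 R, |u r| ^ (p - 1) * χ r ^ 2 * ψ r ^ (n - 1) =
      ∫ r in Ioc 0 R, |u r| ^ (p - 1) * v r ^ 2 * ψ r ^ (n - 1) :=
    setIntegral_congr_fun measurableSet_Ioc fun r hr => by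
      simp only [hχ_left r ⟨by linarith [hr.1], by linarith [hr.2]⟩,
        hχ₀_eq r (Ioc_subset_Icc_self hr)]
  have hright : ∫ r in Ioc 0 R, deriv χ r ^ 2 * ψ r ^ (n - 1) =
      ∫ r in Ioc 0 R, v' r ^ 2 * ψ r ^ (n - 1) :=
    setIntegral_congr_fun measurableSet_Ioc fun r hr => by simp only [hχ_deriv_left r hr]
  rwa [hleft, hright] at key

/-- Stability tested against a nonnegative function on `[0, R]` that vanishes at `R`. -/
lemma Stable.integral_le {n : ℕ} {p : ℝ} {ψ u : ℝ → ℝ} (hs : Stable n p ψ u) (hp : 1 < p)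
    (hψ : ContinuousOn ψ (Ici 0)) (hψ_nonneg : ∀ r ≥ 0, 0 ≤ ψ r) (hu : ContinuousOn u (Ici 0))
    {R : ℝ} (hR : 0 < R) {w w' : ℝ → ℝ}
    (hw : ContinuousOn w (Icc 0 R)) (hw' : ContinuousOn w' (Icc 0 R))
    (hd : ∀ r ∈ Ioo 0 R, HasDerivAt w (w' r) r) (hw_nonneg : ∀ r ∈ Icc 0 R, 0 ≤ w r)
    (hwR : w R = 0) :
    p * ∫ r in (0:ℝ)..R, |u r| ^ (p - 1) * (w r) ^ 2 * ψ r ^ (n - 1) ≤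
      ∫ r in (0:ℝ)..R, (w' r) ^ 2 * ψ r ^ (n - 1) := by
  have hψc : ContinuousOn (fun r => ψ r ^ (n - 1)) (Icc 0 R) :=
    (hψ.mono Icc_subset_Ici_self).pow _
  have hψn : ∀ r ∈ Icc 0 R, 0 ≤ ψ r ^ (n - 1) := fun r hr => pow_nonneg (hψ_nonneg r hr.1) _
  have huc : ContinuousOn (fun r => |u r| ^ (p - 1)) (Icc 0 R) :=
    (hu.mono Icc_subset_Ici_self).abs.rpow_const fun _ _ => Or.inr (by linarith)
  have integrable : ∀ f : ℝ → ℝ, ContinuousOn f (Icc 0 R) → IntervalIntegrable f volume 0 R :=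
    fun f hf => hf.intervalIntegrable_of_Icc hR.le
  set I := ∫ r in (0:ℝ)..R, |u r| ^ (p - 1) * (w r) ^ 2 * ψ r ^ (n - 1)
  set J := ∫ r in (0:ℝ)..R, |u r| ^ (p - 1) * w r * ψ r ^ (n - 1)
  set K := ∫ r in (0:ℝ)..R, (w' r) ^ 2 * ψ r ^ (n - 1)
  have approx : ∀ ε > 0, p * (I - 2 * ε * J) ≤ K := by
    intro ε hε
    have hpos : ∀ r ∈ Icc 0 R, 0 < w r + ε := fun r hr => by linarith [hw_nonneg r hr]
    have hwε : ContinuousOn (fun r => w r + ε) (Icc 0 R) := hw.add continuousOn_const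
    have hv : ContinuousOn (fun r => w r - ε + ε ^ 2 / (w r + ε)) (Icc 0 R) :=
      (hw.sub continuousOn_const).add
        (continuousOn_const.div hwε fun r hr => (hpos r hr).ne')
    have hv' : ContinuousOn (fun r => (1 - ε ^ 2 / (w r + ε) ^ 2) * w' r) (Icc 0 R) :=
      (continuousOn_const.sub (continuousOn_const.div (hwε.pow 2)
        fun r hr => (pow_pos (hpos r hr) 2).ne')).mul hw'
    have key := hs.integral_le_of_deriv_eq_zero hR hv hv' (fun r hr => by
        have hne := (hpos r (Ioo_subset_Icc_self hr)).ne'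
        refine (((hd r hr).sub_const ε).add
          ((hasDerivAt_const r (ε ^ 2)).div ((hd r hr).add_const ε) hne)).congr_deriv ?_
        ring) (by simp only [hwR]; field_simp; ring) (by simp [hwR, hε.ne'])
    have hI : I - 2 * ε * J ≤ ∫ r in (0:ℝ)..R,
        |u r| ^ (p - 1) * (w r - ε + ε ^ 2 / (w r + ε)) ^ 2 * ψ r ^ (n - 1) := by
      have hIi := integrable (fun r => |u r| ^ (p - 1) * w r ^ 2 * ψ r ^ (n - 1))
        ((huc.mul (hw.pow 2)).mul hψc)
      have hJi := integrable (fun r => 2 * ε * (|u r| ^ (p - 1) * w r * ψ r ^ (n - 1)))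
        (continuousOn_const.mul ((huc.mul hw).mul hψc))
      rw [← intervalIntegral.integral_const_mul, ← intervalIntegral.integral_sub hIi hJi]
      refine intervalIntegral.integral_mono_on hR.le (hIi.sub hJi)
        (integrable _ ((huc.mul (hv.pow 2)).mul hψc)) fun r hr => ?_
      have h0 : 0 ≤ |u r| ^ (p - 1) * ψ r ^ (n - 1) :=
        mul_nonneg (Real.rpow_nonneg (abs_nonneg _) _) (hψn r hr)
      have hw0 := hw_nonneg r hr
      have hq : 0 ≤ ε ^ 2 / (w r + ε) := div_nonneg (sq_nonneg _) (hpos r hr).le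
      have hv_eq : w r - ε + ε ^ 2 / (w r + ε) = w r ^ 2 / (w r + ε) := by
        have := (hpos r hr).ne'
        field_simp
        ring
      have hv0 : 0 ≤ w r - ε + ε ^ 2 / (w r + ε) := by
        rw [hv_eq]
        exact div_nonneg (sq_nonneg _) (hpos r hr).le
      have hvw : w r - ε + ε ^ 2 / (w r + ε) ≤ w r := by
        rw [hv_eq, div_le_iff₀ (hpos r hr)]
        nlinarith
      have : w r ^ 2 - 2 * ε * w r ≤ (w r - ε + ε ^ 2 / (w r + ε)) ^ 2 := by nlinarith
      nlinarith [mul_le_mul_of_nonneg_left this h0]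
    have hK : (∫ r in (0:ℝ)..R, ((1 - ε ^ 2 / (w r + ε) ^ 2) * w' r) ^ 2 * ψ r ^ (n - 1)) ≤ K := by
      refine intervalIntegral.integral_mono_on hR.le (integrable _ ((hv'.pow 2).mul hψc))
        (integrable _ ((hw'.pow 2).mul hψc)) fun r hr => ?_
      refine mul_le_mul_of_nonneg_right ?_ (hψn r hr)
      have hq0 : 0 ≤ ε ^ 2 / (w r + ε) ^ 2 := by positivity
      have hq1 : ε ^ 2 / (w r + ε) ^ 2 ≤ 1 := by
        rw [div_le_one (pow_pos (hpos r hr) 2)]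
        nlinarith [hw_nonneg r hr]
      rw [mul_pow]
      exact mul_le_of_le_one_left (sq_nonneg _) (pow_le_one₀ (by linarith) (by linarith))
    calc p * (I - 2 * ε * J) ≤ _ := mul_le_mul_of_nonneg_left hI (by linarith)
      _ ≤ _ := key
      _ ≤ K := hK
  have hlim : Tendsto (fun ε : ℝ => p * (I - 2 * ε * J)) (𝓝[>] 0) (𝓝 (p * I)) := by
    have : Continuous fun ε : ℝ => p * (I - 2 * ε * J) := by fun_prop
    simpa using (this.tendsto 0).mono_left nhdsWithin_le_nhds
  exact le_of_tendsto hlim (eventually_mem_nhdsWithin.mono approx)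

lemma H1.continuousOn {ψ : ℝ → ℝ} (h : H1 ψ) : ContinuousOn ψ (Ici 0) := h.1.continuousOn

lemma H1.nonneg {ψ : ℝ → ℝ} (h : H1 ψ) : ∀ r ≥ 0, 0 ≤ ψ r := fun r hr => by
  rcases hr.eq_or_lt with rfl | hr
  · exact h.2.1.ge
  · exact (h.2.2.2.2 r hr).le

lemma hasDerivAt_derivWithin_Ici {f : ℝ → ℝ} (hf : DifferentiableOn ℝ f (Ici 0)) {r : ℝ}
    (hr : 0 < r) : HasDerivAt f (derivWithin f (Ici 0) r) r :=
  (hf r hr.le).hasDerivWithinAt.hasDerivAt (Ici_mem_nhds hr)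

lemma derivWithin_Ici_eq_deriv (f : ℝ → ℝ) {r : ℝ} (hr : 0 < r) :
    derivWithin f (Ici 0) r = deriv f r := derivWithin_of_mem_nhds (Ici_mem_nhds hr)

lemma IsRadialSolution.differentiableOn {n : ℕ} {p α : ℝ} {ψ u : ℝ → ℝ}
    (hu : IsRadialSolution n p ψ u α) : DifferentiableOn ℝ u (Ici 0) :=
  hu.1.differentiableOn (by norm_num)

lemma IsRadialSolution.contDiffOn_derivWithin {n : ℕ} {p α : ℝ} {ψ u : ℝ → ℝ}
    (hu : IsRadialSolution n p ψ u α) : ContDiffOn ℝ 1 (derivWithin u (Ici 0)) (Ici 0) :=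
  hu.1.derivWithin (uniqueDiffOn_Ici 0) (by norm_num)

lemma IsRadialSolution.hasDerivAt_derivWithin {n : ℕ} {p α : ℝ} {ψ u : ℝ → ℝ}
    (hu : IsRadialSolution n p ψ u α) {r : ℝ} (hr : 0 < r) :
    HasDerivAt (derivWithin u (Ici 0))
      (-((n : ℝ) - 1) * (deriv ψ r / ψ r) * derivWithin u (Ici 0) r - |u r| ^ (p - 1) * u r) r := by
  have h := hasDerivAt_derivWithin_Ici
    (hu.contDiffOn_derivWithin.differentiableOn (by norm_num)) hr
  have hloc : derivWithin u (Ici 0) =ᶠ[𝓝 r] deriv u :=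
    Filter.eventuallyEq_of_mem (Ioi_mem_nhds hr) fun x hx => derivWithin_Ici_eq_deriv u hx
  convert h using 1
  rw [derivWithin_Ici_eq_deriv (derivWithin u (Ici 0)) hr, hloc.deriv_eq,
    derivWithin_Ici_eq_deriv u hr]
  linarith [hu.2.2.2 r hr]

/-- The one-sided derivative of a radial solution vanishes at the origin. -/
lemma IsRadialSolution.derivWithin_zero {n : ℕ} (hn : 3 ≤ n) {p α : ℝ} (hp : 1 < p) {ψ u : ℝ → ℝ}
    (h1 : H1 ψ) (hu : IsRadialSolution n p ψ u α) : derivWithin u (Ici 0) 0 = 0 := by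
  have hn' : (3 : ℝ) ≤ n := by exact_mod_cast hn
  have hψ' : derivWithin ψ (Ici 0) 0 = 1 := by
    have : DifferentiableAt ℝ ψ 0 := by
      by_contra h
      exact one_ne_zero (h1.2.2.1.symm.trans (deriv_zero_of_not_differentiableAt h))
    rw [this.derivWithin (uniqueDiffOn_Ici 0 0 self_mem_Ici), h1.2.2.1]
  have hψ'c : ContinuousOn (derivWithin ψ (Ici 0)) (Ici 0) :=
    h1.1.continuousOn_derivWithin (uniqueDiffOn_Ici 0) (by norm_num)
  have hu' := hu.contDiffOn_derivWithin
  have hu'' : ContinuousOn (derivWithin (derivWithin u (Ici 0)) (Ici 0)) (Ici 0) :=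
    hu'.continuousOn_derivWithin (uniqueDiffOn_Ici 0) le_rfl
  have hpow : ContinuousOn (fun r => |u r| ^ (p - 1) * u r) (Ici 0) :=
    (hu.1.continuousOn.abs.rpow_const fun _ _ => Or.inr (by linarith)).mul hu.1.continuousOn
  have heq : EqOn
      (fun r => ((n : ℝ) - 1) * derivWithin ψ (Ici 0) r * derivWithin u (Ici 0) r)
      (fun r => -(ψ r * (derivWithin (derivWithin u (Ici 0)) (Ici 0) r + |u r| ^ (p - 1) * u r)))
      (Ioi 0) := by
    intro r (hr : 0 < r)
    have hψr := (h1.2.2.2.2 r hr).ne'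
    simp only
    rw [derivWithin_Ici_eq_deriv ψ hr, derivWithin_Ici_eq_deriv (derivWithin u (Ici 0)) hr,
      (hu.hasDerivAt_derivWithin hr).deriv]
    field_simp
    ring
  have h0 := heq.of_subset_closure ((continuousOn_const.mul hψ'c).mul hu'.continuousOn)
    (h1.continuousOn.mul (hu''.add hpow)).neg Ioi_subset_Ici_self (closure_Ioi (0 : ℝ)).ge
    (self_mem_Ici (a := (0 : ℝ)))
  simp only [hψ', h1.2.1, zero_mul, neg_zero, mul_one] at h0
  exact (mul_eq_zero.mp h0).resolve_left (by linarith)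

/-- The radial solution with zero initial value is identically zero. -/
lemma IsRadialSolution.eq_zero {n : ℕ} (hn : 3 ≤ n) {p : ℝ} (hp : 1 < p) {ψ u : ℝ → ℝ}
    (h1 : H1 ψ) (h2 : H2 ψ) (hu : IsRadialSolution n p ψ u 0) : ∀ r ≥ 0, u r = 0 := by
  have hn' : (3 : ℝ) ≤ n := by exact_mod_cast hn
  set u' := derivWithin u (Ici 0) with hu'_def
  set E : ℝ → ℝ := fun r => u' r ^ 2 / 2 + |u r| ^ (p + 1) / (p + 1)
  have hEd : ∀ r > 0, HasDerivAt E (-((n : ℝ) - 1) * (deriv ψ r / ψ r) * u' r ^ 2) r := by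
    intro r hr
    have hpow := (hasDerivAt_abs_rpow (u r) (p := p + 1) (by linarith)).comp r
      (hasDerivAt_derivWithin_Ici hu.differentiableOn hr)
    refine ((((hu.hasDerivAt_derivWithin hr).pow 2).div_const 2).add
      (hpow.div_const (p + 1))).congr_deriv ?_
    rw [show p + 1 - 2 = p - 1 by ring, ← hu'_def]
    have : p + 1 ≠ 0 := by linarith
    field_simp
    push_cast
    ring
  have hEc : ContinuousOn E (Ici 0) :=
    ((hu.contDiffOn_derivWithin.continuousOn.pow 2).div_const 2).add
      ((hu.1.continuousOn.abs.rpow_const fun _ _ => Or.inr (by linarith)).div_const _)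
  have hE : AntitoneOn E (Ici 0) := by
    refine antitoneOn_of_deriv_nonpos (convex_Ici 0) hEc ?_ ?_ <;> rw [interior_Ici]
    · exact fun r hr => (hEd r hr).differentiableAt.differentiableWithinAt
    · intro r hr
      rw [(hEd r hr).deriv]
      have : 0 ≤ ((n : ℝ) - 1) * (deriv ψ r / ψ r) * u' r ^ 2 :=
        mul_nonneg (mul_nonneg (by linarith) (div_nonneg (h2 r hr) (h1.nonneg r (le_of_lt hr))))
          (sq_nonneg _)
      linarith
  have hE0 : E 0 = 0 := by
    simp only [E, hu'_def, hu.derivWithin_zero hn hp h1, hu.2.1, abs_zero]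
    rw [Real.zero_rpow (by linarith)]
    simp
  intro r hr
  have hle : E r ≤ 0 := hE0 ▸ hE self_mem_Ici hr hr
  by_contra hne
  have : 0 < |u r| ^ (p + 1) / (p + 1) :=
    div_pos (Real.rpow_pos_of_pos (abs_pos.mpr hne) _) (by linarith)
  have : 0 < E r := add_pos_of_nonneg_of_pos (by positivity) this
  linarith

lemma rpow_sub_rpow_lt {p a b : ℝ} (hp : 1 < p) (hb : 0 ≤ b) (hab : b < a) :
    a ^ (p - 1) * a - b ^ (p - 1) * b < p * a ^ (p - 1) * (a - b) := by
  have ha : 0 < a := hb.trans_lt hab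
  have hbern := one_add_mul_self_lt_rpow_one_add (s := b / a - 1)
    (by linarith [div_nonneg hb ha.le])
    (by rw [sub_ne_zero]; exact ((div_lt_one ha).mpr hab).ne) hp
  rw [add_sub_cancel, Real.div_rpow hb ha.le, lt_div_iff₀ (Real.rpow_pos_of_pos ha p)] at hbern
  have hrpow : ∀ x : ℝ, 0 ≤ x → x ^ (p - 1) * x = x ^ p := fun x hx => by
    rw [← Real.rpow_add_one' hx (by linarith), sub_add_cancel]
  rw [hrpow b hb]
  rw [← hrpow a ha.le] at hbern
  have : (1 + p * (b / a - 1)) * (a ^ (p - 1) * a) = a ^ (p - 1) * (a - p * (a - b)) := by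
    field_simp
    ring
  linarith

/-- A continuous function on `[0, ∞)` that is positive at `0` but not everywhere has a
first zero. -/
lemma exists_first_zero {w : ℝ → ℝ} (hw : ContinuousOn w (Ici 0)) (h0 : 0 < w 0) {r : ℝ}
    (hr : 0 ≤ r) (hwr : w r ≤ 0) :
    ∃ R > 0, w R = 0 ∧ ∀ x ∈ Ico 0 R, 0 < w x := by
  have ivt : ∀ x ≥ 0, w x ≤ 0 → ∃ z ∈ Icc 0 x, w z = 0 := fun x hx hwx =>
    intermediate_value_Icc' hx (hw.mono Icc_subset_Ici_self) ⟨hwx, h0.le⟩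
  have hclosed : IsClosed (Icc 0 r ∩ w ⁻¹' {0}) :=
    (hw.mono Icc_subset_Ici_self).preimage_isClosed_of_isClosed isClosed_Icc isClosed_singleton
  have hcompact : IsCompact (Icc 0 r ∩ w ⁻¹' {0}) :=
    isCompact_Icc.of_isClosed_subset hclosed inter_subset_left
  obtain ⟨R, ⟨hR, hwR⟩, hleast⟩ := hcompact.exists_isLeast (ivt r hr hwr)
  refine ⟨R, hR.1.lt_of_ne ?_, hwR, fun x hx => ?_⟩
  · rintro rfl
    exact h0.ne' hwR
  · by_contra! hwx
    obtain ⟨z, hz, hwz⟩ := ivt x hx.1 hwx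
    have := hleast ⟨⟨hz.1, hz.2.trans (hx.2.le.trans hR.2)⟩, hwz⟩
    linarith [hz.2, hx.2]

/-- A stable radial solution stays above any nonnegative radial solution with smaller initial
value. -/
lemma IsRadialSolution.lt_of_stable {n : ℕ} (hn : 3 ≤ n) {p : ℝ} (hp : 1 < p) {ψ : ℝ → ℝ}
    (h1 : H1 ψ) {α β : ℝ} (hβα : β < α) {u v : ℝ → ℝ}
    (hu : IsRadialSolution n p ψ u α) (hv : IsRadialSolution n p ψ v β)
    (hs : Stable n p ψ u) (hv_nonneg : ∀ r ≥ 0, 0 ≤ v r) : ∀ r ≥ 0, v r < u r := by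
  have huc := hu.1.continuousOn
  have hvc := hv.1.continuousOn
  by_contra! hcross
  obtain ⟨r, hr, hur⟩ := hcross
  obtain ⟨R, hR, hwR, hw_pos⟩ := exists_first_zero (w := fun r => u r - v r) (huc.sub hvc)
    (by simpa [hu.2.1, hv.2.1] using hβα) hr (by simpa using hur)
  set w : ℝ → ℝ := fun r => u r - v r
  change w R = 0 at hwR
  set u' := derivWithin u (Ici 0)
  set v' := derivWithin v (Ici 0)
  set w' : ℝ → ℝ := fun r => u' r - v' r
  have hsub : Icc 0 R ⊆ Ici 0 := Icc_subset_Ici_self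
  have hwc : ContinuousOn w (Icc 0 R) := (huc.sub hvc).mono hsub
  have hw'c : ContinuousOn w' (Icc 0 R) :=
    (hu.contDiffOn_derivWithin.continuousOn.sub hv.contDiffOn_derivWithin.continuousOn).mono hsub
  have hwd : ∀ r ∈ Ioo 0 R, HasDerivAt w (w' r) r := fun r hr =>
    (hasDerivAt_derivWithin_Ici hu.differentiableOn hr.1).sub
      (hasDerivAt_derivWithin_Ici hv.differentiableOn hr.1)
  have hw_nonneg : ∀ r ∈ Icc 0 R, 0 ≤ w r := fun r hr => by
    rcases hr.2.eq_or_lt with rfl | h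
    · exact hwR.ge
    · exact (hw_pos r ⟨hr.1, h⟩).le
  have hψc : ContinuousOn (fun r => ψ r ^ (n - 1)) (Icc 0 R) := (h1.continuousOn.mono hsub).pow _
  have hrpow : ∀ f : ℝ → ℝ, ContinuousOn f (Ici 0) →
      ContinuousOn (fun r => |f r| ^ (p - 1)) (Icc 0 R) := fun f hf =>
    (hf.mono hsub).abs.rpow_const fun _ _ => Or.inr (by linarith)
  set N : ℝ → ℝ := fun r =>
    (|u r| ^ (p - 1) * u r - |v r| ^ (p - 1) * v r) * w r * ψ r ^ (n - 1)
  have hNc : ContinuousOn N (Icc 0 R) :=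
    ((((hrpow u huc).mul (huc.mono hsub)).sub
      ((hrpow v hvc).mul (hvc.mono hsub))).mul hwc).mul hψc
  have hDc : ContinuousOn (fun r => w' r ^ 2 * ψ r ^ (n - 1)) (Icc 0 R) := (hw'c.pow 2).mul hψc
  have hLc : ContinuousOn (fun r => p * (|u r| ^ (p - 1) * w r ^ 2 * ψ r ^ (n - 1))) (Icc 0 R) :=
    continuousOn_const.mul (((hrpow u huc).mul (hwc.pow 2)).mul hψc)
  have henergy : ∫ r in (0:ℝ)..R, w' r ^ 2 * ψ r ^ (n - 1) = ∫ r in (0:ℝ)..R, N r := by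
    have hflux := intervalIntegral.integral_eq_sub_of_hasDerivAt_of_le hR.le
      (f := fun r => ψ r ^ (n - 1) * w' r * w r)
      (f' := fun r => w' r ^ 2 * ψ r ^ (n - 1) - N r) ((hψc.mul hw'c).mul hwc)
      (fun r hr => by
        have hψr := h1.2.2.2.2 r hr.1
        have hψd : HasDerivAt ψ (deriv ψ r) r :=
          ((h1.1.contDiffAt (Ici_mem_nhds hr.1)).differentiableAt (by norm_num)).hasDerivAt
        have hw'd := (hu.hasDerivAt_derivWithin hr.1).sub (hv.hasDerivAt_derivWithin hr.1)
        refine (((hψd.pow (n - 1)).mul hw'd).mul (hwd r hr)).congr_deriv ?_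
        obtain ⟨m, rfl⟩ : ∃ m, n = m + 2 := ⟨n - 2, by omega⟩
        simp only [N, w', u', v', Pi.sub_apply, Pi.mul_apply, Pi.pow_apply,
          show m + 2 - 1 = m + 1 by omega, Nat.add_sub_cancel]
        push_cast
        field_simp
        ring) ((hDc.sub hNc).intervalIntegrable_of_Icc hR.le)
    rw [intervalIntegral.integral_sub (hDc.intervalIntegrable_of_Icc hR.le)
      (hNc.intervalIntegrable_of_Icc hR.le)] at hflux
    have h0 : ψ 0 ^ (n - 1) = 0 := by rw [h1.2.1, zero_pow (by omega)]
    simp only [hwR, h0, mul_zero, zero_mul, sub_zero] at hflux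
    linarith
  have hN_lt : ∀ r ∈ Ioo 0 R, N r < p * (|u r| ^ (p - 1) * w r ^ 2 * ψ r ^ (n - 1)) := by
    intro r hr
    have hwr : 0 < w r := hw_pos r ⟨hr.1.le, hr.2⟩
    have hvr := hv_nonneg r hr.1.le
    have hlt : v r < u r := sub_pos.mp hwr
    have hconv := rpow_sub_rpow_lt hp hvr hlt
    have hψr : 0 < ψ r ^ (n - 1) := pow_pos (h1.2.2.2.2 r hr.1) _
    simp only [N]
    rw [abs_of_nonneg hvr, abs_of_pos (hvr.trans_lt hlt)]
    calc _ < p * u r ^ (p - 1) * w r * w r * ψ r ^ (n - 1) := by gcongr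
      _ = _ := by ring
  have hN_le : ∀ r ∈ Ioc 0 R, N r ≤ p * (|u r| ^ (p - 1) * w r ^ 2 * ψ r ^ (n - 1)) := by
    intro r hr
    rcases hr.2.eq_or_lt with rfl | h
    · simp [N, hwR]
    · exact (hN_lt r ⟨hr.1, h⟩).le
  have hlt := intervalIntegral.integral_lt_integral_of_continuousOn_of_le_of_exists_lt hR hNc hLc
    hN_le ⟨R / 2, ⟨by linarith, by linarith⟩, hN_lt _ ⟨by linarith, by linarith⟩⟩
  rw [intervalIntegral.integral_const_mul] at hlt
  have hstab := hs.integral_le hp h1.continuousOn h1.nonneg huc hR hwc hw'c hwd hw_nonneg hwR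
  linarith

lemma isRadialSolution_zero (n : ℕ) (p : ℝ) (ψ : ℝ → ℝ) :
    IsRadialSolution n p ψ (fun _ => 0) 0 :=
  ⟨contDiffOn_const, rfl, by simp, fun r _ => by simp⟩

/-- Ordering of stable radial solutions: two stable radial solutions with
initial values 0 ≤ β < α never intersect; in particular, every stable radial
solution with positive initial value is strictly positive on [0,∞). -/
theorem statement16 (n : ℕ) (hn : 3 ≤ n) (p : ℝ) (hp : 1 < p) (ψ : ℝ → ℝ)
    (h1 : H1 ψ) (h2 : H2 ψ) (h3 : H3 ψ)
    (α β : ℝ) (hβ : 0 ≤ β) (hβα : β < α)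
    (uα uβ : ℝ → ℝ)
    (huα : IsRadialSolution n p ψ uα α) (huβ : IsRadialSolution n p ψ uβ β)
    (hsα : Stable n p ψ uα) (hsβ : Stable n p ψ uβ) :
    (∀ r ≥ (0:ℝ), uβ r < uα r) ∧
    (∀ (γ : ℝ) (v : ℝ → ℝ), 0 < γ → IsRadialSolution n p ψ v γ →
      Stable n p ψ v → ∀ r ≥ (0:ℝ), 0 < v r) := by
  have hpos : ∀ (γ : ℝ) (v : ℝ → ℝ), 0 < γ → IsRadialSolution n p ψ v γ →
      Stable n p ψ v → ∀ r ≥ (0:ℝ), 0 < v r := fun γ v hγ hv hs =>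
    hv.lt_of_stable hn hp h1 hγ (isRadialSolution_zero n p ψ) hs fun _ _ => le_rfl
  refine ⟨huα.lt_of_stable hn hp h1 hβα huβ hsα fun r hr => ?_, hpos⟩
  rcases hβ.eq_or_lt with rfl | hβ
  · exact (huβ.eq_zero hn hp h1 h2 r hr).ge
  · exact (hpos β uβ hβ huβ hsβ r hr).le
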